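/- Let H be a PR rational function, not identically zero, with no poles or zeros on jℝ ∪ ∞. Then for every real Y > 0 there exists a real number ν > 0 such that ν·H(ν) = Y. -/

import Mathlib

open Polynomial Matrix

/-- Evaluation of a real rational function at a complex point:
`p(λ)/q(λ)` for `H = p/q` in coprime (num/denom) form. -/
noncomputable def evalC (H : RatFunc ℝ) (z : ℂ) : ℂ :=
  H.num.eval₂ (algebraMap ℝ ℂ) z / H.denom.eval₂ (algebraMap ℝ ℂ) z

/-- Evaluation of a real rational function at a real point. -/
noncomputable def evalR (H : RatFunc ℝ) (x : ℝ) : ℝ :=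
  H.num.eval x / H.denom.eval x

/-- `H` is positive-real: the denominator has no root with strictly positive real
part, and `Re (H λ) ≥ 0` whenever `Re λ > 0`. -/
def IsPR (H : RatFunc ℝ) : Prop :=
  (∀ z : ℂ, 0 < z.re → H.denom.eval₂ (algebraMap ℝ ℂ) z ≠ 0) ∧
  (∀ z : ℂ, 0 < z.re → 0 ≤ (evalC H z).re)

/-- `H` has no poles or zeros on `jℝ ∪ ∞`: numerator and denominator have equal
degree and neither has a purely imaginary root. -/
def NoImagPolesZeros (H : RatFunc ℝ) : Prop :=
  H.num.natDegree = H.denom.natDegree ∧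
  (∀ ω : ℝ, H.num.eval₂ (algebraMap ℝ ℂ) ((ω : ℂ) * Complex.I) ≠ 0) ∧
  (∀ ω : ℝ, H.denom.eval₂ (algebraMap ℝ ℂ) ((ω : ℂ) * Complex.I) ≠ 0)

/-- `H` is a minimum function with minimum frequency `ω₀`. -/
def IsMinFun (H : RatFunc ℝ) (ω₀ : ℝ) : Prop :=
  IsPR H ∧ H ≠ 0 ∧ NoImagPolesZeros H ∧ 0 < ω₀ ∧
    (evalC H ((ω₀ : ℂ) * Complex.I)).re = 0

/-- The McMillan degree of a rational function. -/
noncomputable def McMillanDeg (H : RatFunc ℝ) : ℕ :=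
  max H.num.natDegree H.denom.natDegree

/-- The biquadratic parametrisation of Lemma `bmfp`. -/
noncomputable def Hparam (K ω₀ W F : ℝ) : RatFunc ℝ :=
  RatFunc.C K *
    (RatFunc.X ^ 2 + RatFunc.C (ω₀ * (1 - W) * F / W) * RatFunc.X +
        RatFunc.C (ω₀ ^ 2 * W)) /
    (RatFunc.X ^ 2 + RatFunc.C (ω₀ * (1 - W) / F) * RatFunc.X +
        RatFunc.C (ω₀ ^ 2 / W))

/-- Composition of a rational function with the map `s ↦ ω₀²/s`. -/
noncomputable def freqInv (ω₀ : ℝ) (H : RatFunc ℝ) : RatFunc ℝ :=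
  RatFunc.eval (algebraMap ℝ (RatFunc ℝ)) (RatFunc.C (ω₀ ^ 2) / RatFunc.X) H

theorem evalC_ofReal (H : RatFunc ℝ) (x : ℝ) : evalC H (x : ℂ) = (evalR H x : ℂ) := by
  have h (p : ℝ[X]) : p.eval₂ (algebraMap ℝ ℂ) (x : ℂ) = ((p.eval x : ℝ) : ℂ) :=
    eval₂_at_apply (algebraMap ℝ ℂ) x
  simp [evalC, evalR, h]

theorem denom_eval_ne_zero_of_nonneg {H : RatFunc ℝ} (hPR : IsPR H)
    (hnpz : NoImagPolesZeros H) {x : ℝ} (hx : 0 ≤ x) : H.denom.eval x ≠ 0 := by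
  intro h0
  have h : H.denom.eval₂ (algebraMap ℝ ℂ) (x : ℂ) = 0 := by
    simpa [h0] using eval₂_at_apply (p := H.denom) (algebraMap ℝ ℂ) x
  rcases hx.eq_or_lt with rfl | hx
  · exact hnpz.2.2 0 (by simpa using h)
  · exact hPR.1 x (by simpa using hx) h

theorem IsPR.evalR_nonneg {H : RatFunc ℝ} (hPR : IsPR H) {x : ℝ} (hx : 0 < x) :
    0 ≤ evalR H x := by
  simpa [evalC_ofReal] using hPR.2 x (by simpa using hx)

theorem continuousOn_evalR {H : RatFunc ℝ} (hPR : IsPR H) (hnpz : NoImagPolesZeros H) :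
    ContinuousOn (evalR H) (Set.Ici 0) :=
  H.num.continuous.continuousOn.div H.denom.continuous.continuousOn
    fun _ hx => denom_eval_ne_zero_of_nonneg hPR hnpz hx

open Filter Topology in
theorem tendsto_mul_evalR_atTop {H : RatFunc ℝ} (hPR : IsPR H) (hne : H ≠ 0)
    (hnpz : NoImagPolesZeros H) : Tendsto (fun x => x * evalR H x) atTop atTop := by
  have hnum : H.num ≠ 0 := RatFunc.num_ne_zero hne
  have hlim : Tendsto (evalR H) atTop
      (𝓝 (H.num.leadingCoeff / H.denom.leadingCoeff)) := by
    refine div_tendsto_atTop_leadingCoeff_div_of_degree_eq _ _ ?_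
    rw [degree_eq_natDegree hnum, degree_eq_natDegree H.denom_ne_zero, hnpz.1]
  have hnonneg : 0 ≤ H.num.leadingCoeff / H.denom.leadingCoeff :=
    ge_of_tendsto hlim ((eventually_gt_atTop 0).mono fun _ hx => hPR.evalR_nonneg hx)
  have hpos : 0 < H.num.leadingCoeff / H.denom.leadingCoeff :=
    hnonneg.lt_of_ne' (div_ne_zero (leadingCoeff_ne_zero.2 hnum)
      (leadingCoeff_ne_zero.2 H.denom_ne_zero))
  exact tendsto_id.atTop_mul_pos hpos hlim

/-- a PR function, not identically zero, with no poles or zeros on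
`jℝ ∪ ∞` satisfies: for each `Y > 0` there is `ν > 0` with `ν·H(ν) = Y`. -/
theorem stmt10 (H : RatFunc ℝ) (hPR : IsPR H) (hne : H ≠ 0)
    (hnpz : NoImagPolesZeros H) :
    ∀ Y : ℝ, 0 < Y → ∃ ν : ℝ, 0 < ν ∧ ν * evalR H ν = Y := by
  intro Y hY
  obtain ⟨M, hM, hYM⟩ := ((Filter.eventually_ge_atTop 0).and
    ((tendsto_mul_evalR_atTop hPR hne hnpz).eventually_ge_atTop Y)).exists
  have hcont : ContinuousOn (fun x => x * evalR H x) (Set.Icc 0 M) :=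
    continuousOn_id.mul ((continuousOn_evalR hPR hnpz).mono Set.Icc_subset_Ici_self)
  obtain ⟨ν, hν, hνY⟩ := intermediate_value_Icc hM hcont ⟨by simpa using hY.le, hYM⟩
  refine ⟨ν, hν.1.lt_of_ne ?_, hνY⟩
  rintro rfl
  exact hY.ne (by simpa using hνY)
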